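/- Assume additionally p > 0 and dᵀx ≥ 0 for every x ∈ X. For every integer k with 1 ≤ k ≤ n+1 it holds that adapt(k) ≤ (1 + M̃·(n+1−k)/(k+1))·opt(2RO), where M̃ := (M_∞/m_∞)·(p̄/p); i.e. k second-stage policies suffice to approximate the two-stage robust value with multiplicative factor 1 + M̃·(n+1−k)/(k+1). -/

import Mathlib

open scoped BigOperators

/-- Dot product of two vectors in `ℝ^ν`. -/
noncomputable def dot {ν : ℕ} (c x : Fin ν → ℝ) : ℝ := ∑ j, c j * x j

/-- `convComb S k` is the set of all convex combinations of at most `k` points of `S`. -/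
def convComb {ν : ℕ} (S : Set (Fin ν → ℝ)) (k : ℕ) : Set (Fin ν → ℝ) :=
  { x | ∃ (xs : Fin k → (Fin ν → ℝ)) (lam : Fin k → ℝ),
      (∀ i, xs i ∈ S) ∧ (∀ i, 0 ≤ lam i) ∧ (∑ i, lam i) = 1 ∧
      x = ∑ i, lam i • xs i }

/-- `‖y‖₀`, the number of nonzero entries of `y`, as a real number. -/
noncomputable def zeroNorm {ν : ℕ} (y : Fin ν → ℝ) : ℝ :=
  ((Finset.univ.filter (fun j => y j ≠ 0)).card : ℝ)

/-- The `k`-adaptability value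
`adapt(k) = inf_{x ∈ X, y¹,…,y^k ∈ Y(x)} max_{ξ ∈ U} min_{i=1,…,k} (dᵀx + ξᵀyⁱ)`. -/
noncomputable def adaptVal {μ ν : ℕ} (X : Set (Fin μ → ℝ)) (d : Fin μ → ℝ)
    (Y : (Fin μ → ℝ) → Set (Fin ν → ℝ)) (U : Set (Fin ν → ℝ)) (k : ℕ) : ℝ :=
  sInf { v : ℝ | ∃ x ∈ X, ∃ ys : Fin k → (Fin ν → ℝ), (∀ i, ys i ∈ Y x) ∧
    v = sSup ((fun ξ => dot d x + ⨅ i, dot ξ (ys i)) '' U) }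

/-- The two-stage robust value
`opt(2RO) = inf_{x ∈ X} max_{ξ ∈ U} min_{y ∈ Y(x)} (dᵀx + ξᵀy)`. -/
noncomputable def twoStageVal {μ ν : ℕ} (X : Set (Fin μ → ℝ)) (d : Fin μ → ℝ)
    (Y : (Fin μ → ℝ) → Set (Fin ν → ℝ)) (U : Set (Fin ν → ℝ)) : ℝ :=
  sInf { v : ℝ | ∃ x ∈ X, v = sSup ((fun ξ => dot d x + ⨅ y : (Y x), dot ξ (y : Fin ν → ℝ)) '' U) }

lemma dot_sum_smul {n : ℕ} {ι : Type*} [Fintype ι] (ξ : Fin n → ℝ) (w : ι → ℝ)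
    (z : ι → Fin n → ℝ) : dot ξ (∑ i, w i • z i) = ∑ i, w i * dot ξ (z i) := by
  change ξ ⬝ᵥ _ = ∑ i, w i * (ξ ⬝ᵥ z i)
  simp [dotProduct_sum, dotProduct_smul]

/-- The dot product with a binary vector is at least `a` times its number of nonzero entries, if
every entry of the other vector is at least `a`. -/
lemma mul_zeroNorm_le_dot {n : ℕ} {ξ y : Fin n → ℝ} {a : ℝ} (hξ : ∀ j, a ≤ ξ j)
    (hy : ∀ j, y j = 0 ∨ y j = 1) : a * zeroNorm y ≤ dot ξ y := by
  rw [zeroNorm, dot, Finset.card_filter, Nat.cast_sum, Finset.mul_sum]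
  refine Finset.sum_le_sum fun j _ => ?_
  rcases hy j with h | h <;> simp [h, hξ j]

/-- The dot product with a binary vector is at most `b` times its number of nonzero entries, if
every entry of the other vector is at most `b`. -/
lemma dot_le_mul_zeroNorm {n : ℕ} {ξ y : Fin n → ℝ} {b : ℝ} (hξ : ∀ j, ξ j ≤ b)
    (hy : ∀ j, y j = 0 ∨ y j = 1) : dot ξ y ≤ b * zeroNorm y := by
  rw [zeroNorm, dot, Finset.card_filter, Nat.cast_sum, Finset.mul_sum]
  refine Finset.sum_le_sum fun j _ => ?_
  rcases hy j with h | h <;> simp [h, hξ j]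

/-- Among the subsets of `s` with `k` elements, one carries at least the average weight. -/
lemma exists_subset_card_eq_mul_sum_le {ι : Type*} [DecidableEq ι] (w : ι → ℝ) (s : Finset ι)
    {k : ℕ} (hk : k ≤ s.card) :
    ∃ t ⊆ s, t.card = k ∧ (k : ℝ) * ∑ i ∈ s, w i ≤ s.card * ∑ i ∈ t, w i := by
  have top : ∃ t ⊆ s, t.card = k ∧ ∀ i ∈ t, ∀ j ∈ s \ t, w j ≤ w i := by
    induction k with
    | zero => exact ⟨∅, by simp⟩
    | succ k ih =>
      obtain ⟨t, hts, htc, ht⟩ := ih (by omega)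
      have hne : (s \ t).Nonempty := by
        rw [← Finset.card_pos, Finset.card_sdiff_of_subset hts]; omega
      obtain ⟨a, ha, hmax⟩ := Finset.exists_max_image (s \ t) w hne
      have ha' := Finset.mem_sdiff.1 ha
      refine ⟨insert a t, Finset.insert_subset ha'.1 hts, by
        rw [Finset.card_insert_of_notMem ha'.2, htc], fun i hi j hj => ?_⟩
      have hj' : j ∈ s \ t := by
        simp only [Finset.mem_sdiff, Finset.mem_insert, not_or] at hj ⊢
        exact ⟨hj.1, hj.2.2⟩
      rcases Finset.mem_insert.1 hi with rfl | hi
      · exact hmax j hj'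
      · exact ht i hi j hj'
  obtain ⟨t, hts, htc, ht⟩ := top
  refine ⟨t, hts, htc, ?_⟩
  have hdouble : ∑ i ∈ t, ∑ j ∈ s \ t, w j ≤ ∑ i ∈ t, ∑ j ∈ s \ t, w i :=
    Finset.sum_le_sum fun i hi => Finset.sum_le_sum fun j hj => ht i hi j hj
  have hcard : ((s \ t).card : ℝ) = s.card - k := by
    rw [Finset.card_sdiff_of_subset hts, htc, Nat.cast_sub hk]
  simp only [Finset.sum_const, nsmul_eq_mul, htc, hcard, ← Finset.mul_sum] at hdouble
  rw [← Finset.sum_sdiff hts]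
  linarith

/-- A nonempty finite set with at most `k` elements is enumerated by `Fin k`. -/
lemma exists_fin_range_eq {α : Type*} {t : Finset α} (ht : t.Nonempty) {k : ℕ} (hk : t.card ≤ k) :
    ∃ f : Fin k → α, Set.range f = t := by
  have : Nonempty t := ht.to_subtype
  obtain ⟨e⟩ : Nonempty (t ↪ Fin k) := Function.Embedding.nonempty_of_card_le (by simpa using hk)
  refine ⟨fun i => (Function.invFun e i : t), Set.ext fun a => ⟨?_, fun ha => ?_⟩⟩
  · rintro ⟨i, rfl⟩
    exact (Function.invFun e i : t).2
  · exact ⟨e ⟨a, ha⟩, by simp [Function.leftInverse_invFun e.injective _]⟩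

/-- The minimax theorem for the bilinear form `dot`. -/
lemma exists_dot_saddlePoint {n : ℕ} {S U : Set (Fin n → ℝ)} (hS : S.Finite) (hSne : S.Nonempty)
    (hUne : U.Nonempty) (hUcomp : IsCompact U) (hUconv : Convex ℝ U) :
    ∃ y₀ ∈ convexHull ℝ S, ∃ ξ₀ ∈ U, ∀ ξ ∈ U, ∀ y ∈ S, dot ξ y₀ ≤ dot ξ₀ y := by
  have hlin₁ (ξ : Fin n → ℝ) : IsLinearMap ℝ (fun y => dot ξ y) :=
    ⟨fun a b => dotProduct_add ξ a b, fun c a => dotProduct_smul c ξ a⟩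
  have hlin₂ (y : Fin n → ℝ) : IsLinearMap ℝ (fun ξ => dot ξ y) :=
    ⟨fun a b => add_dotProduct a b y, fun c a => smul_dotProduct c a y⟩
  have hcont₁ (ξ : Fin n → ℝ) : Continuous (fun y => dot ξ y) := by unfold dot; fun_prop
  have hcont₂ (y : Fin n → ℝ) : Continuous (fun ξ => dot ξ y) := by unfold dot; fun_prop
  obtain ⟨y₀, hy₀, ξ₀, hξ₀, h⟩ := Sion.exists_isSaddlePointOn (f := fun y ξ => dot ξ y)
    (hSne.convexHull (𝕜 := ℝ)) (convex_convexHull ℝ S) (hS.isCompact_convexHull ℝ)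
    (fun ξ _ => (hcont₁ ξ).lowerSemicontinuous.lowerSemicontinuousOn _)
    (fun ξ _ => (((hlin₁ ξ).mk' _).convexOn (convex_convexHull ℝ S)).quasiconvexOn)
    hUconv hUne hUcomp
    (fun y _ => (hcont₂ y).upperSemicontinuous.upperSemicontinuousOn _)
    (fun y _ => (((hlin₂ y).mk' _).concaveOn hUconv).quasiconcaveOn)
  exact ⟨y₀, hy₀, ξ₀, hξ₀, fun ξ hξ y hy => h y (subset_convexHull ℝ S hy) ξ hξ⟩

/-- Every point of a convex hull has a convex representation in which some set of at most `k`
points carries at least the fraction `k / (n + 1)` of the weight. -/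
lemma exists_representation_with_heavy_subset {n : ℕ} {S : Set (Fin n → ℝ)} {y : Fin n → ℝ}
    (hy : y ∈ convexHull ℝ S) {k : ℕ} (hk : 1 ≤ k) (hkn : k ≤ n + 1) :
    ∃ (ι : Type) (_ : Fintype ι) (z : ι → Fin n → ℝ) (w : ι → ℝ) (t : Finset ι),
      (∀ i, z i ∈ S) ∧ (∀ i, 0 ≤ w i) ∧ ∑ i, w i = 1 ∧ ∑ i, w i • z i = y ∧
      t.Nonempty ∧ t.card ≤ k ∧ (k : ℝ) ≤ (n + 1) * ∑ i ∈ t, w i := by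
  classical
  obtain ⟨ι, _, z, w, hz, hind, hw, hw1, hwy⟩ := eq_pos_convex_span_of_mem_convexHull hy
  have hN : Fintype.card ι ≤ n + 1 := by
    refine hind.card_le_finrank_succ.trans (Nat.succ_le_succ ?_)
    simpa using Submodule.finrank_le (vectorSpan ℝ (Set.range z))
  have hne : 0 < Fintype.card ι := by
    refine Fintype.card_pos_iff.2 (not_isEmpty_iff.1 fun h => ?_)
    simp at hw1
  have hnn : (Fintype.card ι : ℝ) ≤ n + 1 := by exact_mod_cast hN
  have hkn' : (k : ℝ) ≤ n + 1 := by exact_mod_cast hkn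
  rcases le_total (Fintype.card ι) k with h | h
  · refine ⟨ι, _, z, w, Finset.univ, fun i => hz ⟨i, rfl⟩, fun i => (hw i).le, hw1, hwy,
      Finset.card_pos.1 hne, h, ?_⟩
    rw [hw1, mul_one]
    exact hkn'
  · obtain ⟨t, -, htc, ht⟩ := exists_subset_card_eq_mul_sum_le w Finset.univ (k := k) h
    refine ⟨ι, _, z, w, t, fun i => hz ⟨i, rfl⟩, fun i => (hw i).le, hw1, hwy,
      Finset.card_pos.1 (by omega), htc.le, ?_⟩
    rw [hw1, mul_one, Finset.card_univ] at ht
    exact ht.trans (mul_le_mul_of_nonneg_right hnn (Finset.sum_nonneg fun i _ => (hw i).le))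

/-- `k` policies approximate the max-min value of `dot` over `U` and `S`. -/
lemma exists_policies_iInf_dot_le {n : ℕ} {S U : Set (Fin n → ℝ)} (hS : S.Finite)
    (hSne : S.Nonempty) (hUne : U.Nonempty) (hUcomp : IsCompact U) (hUconv : Convex ℝ U)
    {a b : ℝ} (ha : 0 < a) (hab : ∀ ξ ∈ U, ∀ y ∈ S, a ≤ dot ξ y ∧ dot ξ y ≤ b)
    {k : ℕ} (hk : 1 ≤ k) (hkn : k ≤ n + 1) :
    ∃ ys : Fin k → Fin n → ℝ, (∀ i, ys i ∈ S) ∧ ∃ ξ₀ ∈ U, ∀ ξ ∈ U, ∀ y ∈ S,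
      ⨅ i, dot ξ (ys i) ≤ (1 + b / a * (((n : ℝ) + 1 - k) / ((k : ℝ) + 1))) * dot ξ₀ y := by
  classical
  obtain ⟨y₀, hy₀, ξ₀, hξ₀, hsaddle⟩ := exists_dot_saddlePoint hS hSne hUne hUcomp hUconv
  obtain ⟨ι, _, z, w, t, hz, hw, hw1, rfl, htne, htk, hheavy⟩ :=
    exists_representation_with_heavy_subset hy₀ hk hkn
  obtain ⟨ys, hys⟩ := exists_fin_range_eq (htne.image z) (Finset.card_image_le.trans htk)
  have hysS (i : Fin k) : ys i ∈ S := by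
    have : ys i ∈ Set.range ys := ⟨i, rfl⟩
    rw [hys, Finset.mem_coe, Finset.mem_image] at this
    obtain ⟨j, -, hj⟩ := this
    exact hj ▸ hz j
  refine ⟨ys, hysS, ξ₀, hξ₀, fun ξ hξ y hy => ?_⟩
  have hτle (i : Fin k) : ⨅ i, dot ξ (ys i) ≤ dot ξ (ys i) :=
    ciInf_le (Set.finite_range _).bddBelow i
  set τ := ⨅ i, dot ξ (ys i)
  set v := dot ξ₀ y
  have hτb : τ ≤ b := (hτle ⟨0, hk⟩).trans (hab ξ hξ _ (hysS _)).2
  have hva : a ≤ v := (hab ξ₀ hξ₀ y hy).1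
  have hb : 0 < b := ha.trans_le ((hab ξ₀ hξ₀ y hy).1.trans (hab ξ₀ hξ₀ y hy).2)
  have hτt : ∀ i ∈ t, τ ≤ dot ξ (z i) := fun i hi => by
    obtain ⟨j, hj⟩ : z i ∈ Set.range ys := by
      rw [hys]; exact Finset.mem_image_of_mem z hi
    exact hj ▸ hτle j
  have hv : (∑ i ∈ t, w i) * τ ≤ v := calc
    (∑ i ∈ t, w i) * τ = ∑ i ∈ t, w i * τ := Finset.sum_mul ..
    _ ≤ ∑ i ∈ t, w i * dot ξ (z i) :=
      Finset.sum_le_sum fun i hi => mul_le_mul_of_nonneg_left (hτt i hi) (hw i)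
    _ ≤ ∑ i, w i * dot ξ (z i) :=
      Finset.sum_le_sum_of_subset_of_nonneg (Finset.subset_univ t) fun i _ _ =>
        mul_nonneg (hw i) (ha.le.trans (hab ξ hξ _ (hz i)).1)
    _ = dot ξ (∑ i, w i • z i) := (dot_sum_smul ξ w z).symm
    _ ≤ v := hsaddle ξ hξ y hy
  have hΛ1 : ∑ i ∈ t, w i ≤ 1 :=
    hw1 ▸ Finset.sum_le_sum_of_subset_of_nonneg (Finset.subset_univ t) fun i _ _ => hw i
  set Λ := ∑ i ∈ t, w i
  have hfrac : 1 - Λ ≤ ((n : ℝ) + 1 - k) / ((k : ℝ) + 1) := by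
    rw [le_div_iff₀ (by positivity)]
    rcases hkn.lt_or_eq with h | h
    · have h' : (k : ℝ) + 1 ≤ n + 1 := by exact_mod_cast h
      nlinarith
    · have h' : (k : ℝ) = n + 1 := by exact_mod_cast h
      nlinarith
  have hbv : b ≤ b / a * v := by
    rw [div_mul_eq_mul_div, le_div_iff₀ ha]
    exact mul_le_mul_of_nonneg_left hva hb.le
  calc τ = Λ * τ + (1 - Λ) * τ := by ring
    _ ≤ v + (1 - Λ) * b := add_le_add hv (mul_le_mul_of_nonneg_left hτb (sub_nonneg.2 hΛ1))
    _ ≤ v + ((n : ℝ) + 1 - k) / ((k : ℝ) + 1) * (b / a * v) := by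
      refine add_le_add le_rfl (mul_le_mul hfrac hbv hb.le ((sub_nonneg.2 hΛ1).trans hfrac))
    _ = _ := by ring

/-- Assume `p > 0` and `dᵀx ≥ 0` for every `x ∈ X`. For every `1 ≤ k ≤ n+1`,
`adapt(k) ≤ (1 + M̃·(n+1−k)/(k+1))·opt(2RO)` with `M̃ = (M_∞/m_∞)·(p̄/p)`. -/
theorem stmt18 (m n : ℕ) (hm : 0 < m) (hn : 0 < n)
    (X : Set (Fin m → ℝ)) (hXne : X.Nonempty) (hXcomp : IsCompact X)
    (d : Fin m → ℝ)
    (Y : (Fin m → ℝ) → Set (Fin n → ℝ))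
    (hYfin : ∀ x ∈ X, (Y x).Finite) (hYne : ∀ x ∈ X, (Y x).Nonempty)
    (hYbin : ∀ x ∈ X, ∀ y ∈ Y x, ∀ j, y j = 0 ∨ y j = 1)
    (U : Set (Fin n → ℝ)) (hUne : U.Nonempty) (hUcomp : IsCompact U) (hUconv : Convex ℝ U)
    (m_inf M_inf : ℝ) (hminf : 0 < m_inf) (hmM : m_inf ≤ M_inf)
    (hxi : ∀ ξ ∈ U, ∀ j, m_inf ≤ ξ j ∧ ξ j ≤ M_inf)
    (p pbar : ℝ) (hp0 : 0 ≤ p) (hppbar : p ≤ pbar)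
    (hpy : ∀ x ∈ X, ∀ y ∈ Y x, p ≤ zeroNorm y ∧ zeroNorm y ≤ pbar)
    (hppos : 0 < p) (hd : ∀ x ∈ X, 0 ≤ dot d x)
    (k : ℕ) (hk : 1 ≤ k) (hkn : k ≤ n + 1) :
    adaptVal X d Y U k ≤
      (1 + (M_inf / m_inf) * (pbar / p) * (((n : ℝ) + 1 - k) / ((k : ℝ) + 1))) *
        twoStageVal X d Y U := by
  have hM : 0 < M_inf := hminf.trans_le hmM
  have hdot : ∀ x ∈ X, ∀ ξ ∈ U, ∀ y ∈ Y x,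
      m_inf * p ≤ dot ξ y ∧ dot ξ y ≤ M_inf * pbar := fun x hx ξ hξ y hy =>
    ⟨(mul_le_mul_of_nonneg_left (hpy x hx y hy).1 hminf.le).trans
      (mul_zeroNorm_le_dot (fun j => (hxi ξ hξ j).1) (hYbin x hx y hy)),
    (dot_le_mul_zeroNorm (fun j => (hxi ξ hξ j).2) (hYbin x hx y hy)).trans
      (mul_le_mul_of_nonneg_left (hpy x hx y hy).2 hM.le)⟩
  have ha : 0 < m_inf * p := mul_pos hminf hppos
  have hpbar : 0 < pbar := hppos.trans_le hppbar
  have hkn' : (0 : ℝ) ≤ (n : ℝ) + 1 - k := sub_nonneg.2 (by exact_mod_cast hkn)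
  rw [← mul_div_mul_comm]
  set γ := M_inf * pbar / (m_inf * p) * (((n : ℝ) + 1 - k) / ((k : ℝ) + 1)) with hγ_def
  have hγ : 0 ≤ γ := by positivity
  have hC : 0 < 1 + γ := by linarith
  rw [mul_comm, ← div_le_iff₀ hC]
  refine le_csInf (hXne.elim fun x hx => ⟨_, x, hx, rfl⟩) ?_
  rintro _ ⟨x, hx, rfl⟩
  rw [div_le_iff₀ hC, mul_comm]
  have : Nonempty (Y x) := (hYne x hx).to_subtype
  have : Finite (Y x) := (hYfin x hx).to_subtype
  obtain ⟨ys, hys, ξ₀, hξ₀, happrox⟩ := exists_policies_iInf_dot_le (hYfin x hx) (hYne x hx)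
    hUne hUcomp hUconv ha (hdot x hx) hk hkn
  rw [← hγ_def] at happrox
  have hbelow : BddBelow { v : ℝ | ∃ x ∈ X, ∃ ys : Fin k → (Fin n → ℝ), (∀ i, ys i ∈ Y x) ∧
      v = sSup ((fun ξ => dot d x + ⨅ i, dot ξ (ys i)) '' U) } := by
    refine ⟨0, ?_⟩
    rintro _ ⟨x, hx, ys, hys, rfl⟩
    refine Real.sSup_nonneg ?_
    rintro _ ⟨ξ, hξ, rfl⟩
    exact add_nonneg (hd x hx)
      (Real.iInf_nonneg fun i => ha.le.trans (hdot x hx ξ hξ _ (hys i)).1)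
  have habove : BddAbove ((fun ξ => dot d x + ⨅ y : (Y x), dot ξ (y : Fin n → ℝ)) '' U) := by
    refine ⟨dot d x + M_inf * pbar, ?_⟩
    rintro _ ⟨ξ, hξ, rfl⟩
    obtain ⟨y⟩ := ‹Nonempty (Y x)›
    exact add_le_add le_rfl
      ((ciInf_le (Set.finite_range _).bddBelow y).trans (hdot x hx ξ hξ y y.2).2)
  obtain ⟨y, hy⟩ := exists_eq_ciInf_of_finite (f := fun y : Y x => dot ξ₀ (y : Fin n → ℝ))
  refine (csInf_le hbelow ⟨x, hx, ys, hys, rfl⟩).trans (csSup_le (hUne.image _) ?_)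
  rintro _ ⟨ξ, hξ, rfl⟩
  calc dot d x + ⨅ i, dot ξ (ys i) ≤ dot d x + (1 + γ) * dot ξ₀ y :=
      add_le_add le_rfl (happrox ξ hξ y y.2)
    _ ≤ (1 + γ) * (dot d x + dot ξ₀ y) := by nlinarith [mul_nonneg hγ (hd x hx)]
    _ ≤ _ := mul_le_mul_of_nonneg_left (le_csSup habove ⟨ξ₀, hξ₀, by simp only [hy]⟩) hC.le
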